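/- Any union 𝒞_k : (f₀ + t₁z¹⁰)(f₀ + t₂z¹⁰)⋯(f₀ + t_kz¹⁰) = 0 of k ≥ 2 distinct members of the pencil f₀ + tz¹⁰ = 0, with t₁, …, t_k ∈ ℂ distinct, is a free curve with exponents (9, 10k−10), and the union 𝒞_k ∪ L_z with the line at infinity L_z : z = 0 is free with exponents (9, 10k−9). The same statements hold for the pencil f'₀ + tz¹⁰ = 0. -/

import Mathlib

open MvPolynomial

noncomputable section

/-- `S = ℂ[x,y,z]`, with `x = X 0`, `y = X 1`, `z = X 2`. -/
abbrev S3 := MvPolynomial (Fin 3) ℂ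

/-- The graded `S`-module `D_0(f)` of Jacobian syzygies of `f`. -/
def jacSyz (f : S3) : Submodule S3 (Fin 3 → S3) where
  carrier := {v | v 0 * pderiv 0 f + v 1 * pderiv 1 f + v 2 * pderiv 2 f = 0}
  add_mem' := by
    intro a b ha hb
    simp only [Set.mem_setOf_eq, Pi.add_apply] at *
    linear_combination ha + hb
  zero_mem' := by simp
  smul_mem' := by
    intro c v hv
    simp only [Set.mem_setOf_eq, Pi.smul_apply, smul_eq_mul] at *
    linear_combination c * hv

/-- `v` is a minimal system of `m` homogeneous generators of `D_0(f)`, the generator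
`v j` being a syzygy of degree `dd j`, and `dd` nondecreasing: this says that
`C : f = 0` is an `m`-syzygy curve with exponents `dd`. -/
structure IsMinGenSyz (f : S3) (m : ℕ) (dd : Fin m → ℕ) (v : Fin m → (Fin 3 → S3)) : Prop where
  mem : ∀ j, v j ∈ jacSyz f
  hom : ∀ j i, ((v j) i).IsHomogeneous (dd j)
  ne_zero : ∀ j, v j ≠ 0
  span_eq : Submodule.span S3 (Set.range v) = jacSyz f
  minimal : ∀ j, v j ∉ Submodule.span S3 (v '' {j' | j' ≠ j})
  mono : Monotone dd

/-- `C : f = 0` is free with exponents `(d1, d2)`. -/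
def IsFreeWith (f : S3) (d1 d2 : ℕ) : Prop := ∃ v, IsMinGenSyz f 2 ![d1, d2] v

/-- `C : f = 0` is a free curve (a 2-syzygy curve). -/
def IsFreeCurve (f : S3) : Prop := ∃ d1 d2, IsFreeWith f d1 d2

/-- `C : f = 0` of degree `d` is nearly free with exponents `(d1, d2)`:
a 3-syzygy curve with exponents `(d1, d2, d2)` and `d1 + d2 = d`. -/
def IsNearlyFreeWith (f : S3) (d d1 d2 : ℕ) : Prop :=
  d1 + d2 = d ∧ ∃ v, IsMinGenSyz f 3 ![d1, d2, d2] v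

/-- `C : f = 0` of degree `d` is a nearly free curve. -/
def IsNearlyFree (f : S3) (d : ℕ) : Prop := ∃ d1 d2, IsNearlyFreeWith f d d1 d2

/-- `C : f = 0` of degree `d` is plus-one generated with exponents `(d1, d2, d3)`:
a 3-syzygy curve with `d1 + d2 = d`. -/
def IsPOGWith (f : S3) (d d1 d2 d3 : ℕ) : Prop :=
  d1 + d2 = d ∧ ∃ v, IsMinGenSyz f 3 ![d1, d2, d3] v

/-- `C : f = 0` of degree `d` is a plus-one generated curve. -/
def IsPOG (f : S3) (d : ℕ) : Prop := ∃ d1 d2 d3, IsPOGWith f d d1 d2 d3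

/-- `C : f = 0` of degree `d` is minimal plus-one generated (MPOG),
with exponents `(d1, d2, d2 + 1)`. -/
def IsMPOGWith (f : S3) (d d1 d2 : ℕ) : Prop := IsPOGWith f d d1 d2 (d2 + 1)

/-- `C : f = 0` of degree `d` is an MPOG-curve. -/
def IsMPOG (f : S3) (d : ℕ) : Prop := ∃ d1 d2, IsMPOGWith f d d1 d2

/-- `r = mdr(f)`: the minimal degree of a nonzero (homogeneous) Jacobian relation for `f`. -/
def IsMDR (f : S3) (r : ℕ) : Prop :=
  (∃ v ∈ jacSyz f, v ≠ 0 ∧ ∀ i, (v i).IsHomogeneous r) ∧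
  ∀ m, m < r → ∀ v ∈ jacSyz f, (∀ i, (v i).IsHomogeneous m) → v = 0

/-- The Jacobian ideal `J_f` of `f`. -/
def jacobianIdeal (f : S3) : Ideal S3 := Ideal.span {pderiv 0 f, pderiv 1 f, pderiv 2 f}

/-- The dimension of the degree `k` graded piece of the Milnor algebra `M(f) = S/J_f`. -/
def milnorDim (f : S3) (k : ℕ) : ℕ :=
  Module.finrank ℂ
    (↥(homogeneousSubmodule (Fin 3) ℂ k) ⧸
      (Submodule.comap (homogeneousSubmodule (Fin 3) ℂ k).subtype
        (Submodule.restrictScalars ℂ (jacobianIdeal f))))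

/-- `τ` is the total Tjurina number of the reduced curve `C : f = 0`, i.e. the degree of the
Jacobian ideal `J_f`: for all large `k` one has `dim M(f)_k = τ`. -/
def IsTjurina (f : S3) (τ : ℕ) : Prop := ∀ᶠ k in Filter.atTop, milnorDim f k = τ

/-- `C : f = 0` is a maximal Tjurina curve of type `(d, r)`. -/
def IsMaxTjurina (f : S3) (d r : ℕ) : Prop :=
  IsMDR f r ∧ d ≤ 2 * r ∧
  ∃ τ : ℕ, IsTjurina f τ ∧
    (τ : ℤ) = ((d : ℤ) - 1) ^ 2 - r * ((d : ℤ) - r - 1) - (Nat.choose (2 * r + 2 - d) 2 : ℤ)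

/-- `f` is a product of `d` linear forms all vanishing at a common point, i.e.
`C : f = 0` is the union of `d` lines passing through one point. -/
def IsUnionOfConcurrentLines (f : S3) (d : ℕ) : Prop :=
  ∃ (c : ℂ) (L : Fin d → Fin 3 → ℂ) (v : Fin 3 → ℂ), v ≠ 0 ∧
    f = C c * ∏ j, (∑ i, C (L j i) * X i) ∧ ∀ j, (∑ i, L j i * v i) = 0

/-- The ideal `I_θ` generated by the 2×2 minors of the matrix with rows `(x,y,z)` and
`(a,b,c)`, defining the eigenscheme `Γ_θ` of the derivation `θ = a ∂_x + b ∂_y + c ∂_z`. -/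
def eigenIdeal (a b c : S3) : Ideal S3 :=
  Ideal.span {X 1 * c - X 2 * b, X 2 * a - X 0 * c, X 0 * b - X 1 * a}

/-- The projective plane `ℙ²(ℂ)`. -/
abbrev Pt := Projectivization ℂ (Fin 3 → ℂ)

/-- The eigenscheme `Γ_θ` of `θ = a ∂_x + b ∂_y + c ∂_z` is 0-dimensional:
its set of points in `ℙ²` is finite. -/
def EigenSchemeFinite (a b c : S3) : Prop :=
  {p : Pt | eval p.rep (X 1 * c - X 2 * b) = 0 ∧ eval p.rep (X 2 * a - X 0 * c) = 0 ∧
      eval p.rep (X 0 * b - X 1 * a) = 0}.Finite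

/-- The homogenization `f₀` of the Briançon polynomial `g`. -/
def f0 : S3 :=
  X 0 ^ 6 * X 1 ^ 4 + 4 * X 0 ^ 5 * X 1 ^ 3 * X 2 ^ 2 + 3 * X 0 ^ 4 * X 1 ^ 3 * X 2 ^ 3 +
    6 * X 0 ^ 4 * X 1 ^ 2 * X 2 ^ 4 + C (19 / 3 : ℂ) * X 0 ^ 3 * X 1 ^ 2 * X 2 ^ 5 +
    4 * X 0 ^ 3 * X 1 * X 2 ^ 6 + 3 * X 0 ^ 2 * X 1 ^ 2 * X 2 ^ 6 +
    C (11 / 3 : ℂ) * X 0 ^ 2 * X 1 * X 2 ^ 7 + X 0 ^ 2 * X 2 ^ 8 + 2 * X 0 * X 1 * X 2 ^ 8 +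
    C (1 / 3 : ℂ) * X 0 * X 2 ^ 9 + X 1 * X 2 ^ 9 - X 2 ^ 10

/-- `f_b = f₀ + (16/9) z¹⁰`. -/
def fb : S3 := f0 + C (16 / 9 : ℂ) * X 2 ^ 10

/-- `f₁ = f₀ - z¹⁰`. -/
def f1 : S3 := f0 - X 2 ^ 10

/-- The homogenization `f'₀` of the Briançon-type polynomial `g'`. -/
def f0' : S3 :=
  X 0 ^ 6 * X 1 ^ 4 + 4 * X 0 ^ 5 * X 1 ^ 3 * X 2 ^ 2 + 3 * X 0 ^ 4 * X 1 ^ 3 * X 2 ^ 3 +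
    6 * X 0 ^ 4 * X 1 ^ 2 * X 2 ^ 4 + C (65 / 9 : ℂ) * X 0 ^ 3 * X 1 ^ 2 * X 2 ^ 5 +
    4 * X 0 ^ 3 * X 1 * X 2 ^ 6 + 3 * X 0 ^ 2 * X 1 ^ 2 * X 2 ^ 6 +
    C (49 / 9 : ℂ) * X 0 ^ 2 * X 1 * X 2 ^ 7 + X 0 ^ 2 * X 2 ^ 8 +
    C (10 / 3 : ℂ) * X 0 * X 1 * X 2 ^ 8 + C (11 / 9 : ℂ) * X 0 * X 2 ^ 9 + X 1 * X 2 ^ 9 +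
    C (1 / 3 : ℂ) * X 2 ^ 10

/-- `f'_{b'} = f'₀ + (64/81) z¹⁰`. -/
def fb' : S3 := f0' + C (64 / 81 : ℂ) * X 2 ^ 10

/-- `f'₁ = f'₀ - z¹⁰`. -/
def f1' : S3 := f0' - X 2 ^ 10

/-- The product rule for a derivation and a finite product. -/
lemma derivation_prod {ι R A : Type*} [DecidableEq ι] [CommSemiring R] [CommSemiring A]
    [Algebra R A] (D : Derivation R A A) (s : Finset ι) (g : ι → A) :
    D (∏ i ∈ s, g i) = ∑ i ∈ s, (∏ j ∈ s.erase i, g j) * D (g i) := by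
  induction s using Finset.induction_on with
  | empty => simp
  | insert a s ha ih =>
    rw [Finset.prod_insert ha, Derivation.leibniz, ih, Finset.sum_insert ha,
      Finset.erase_insert ha, smul_eq_mul, smul_eq_mul, Finset.mul_sum, add_comm]
    congr 1
    refine Finset.sum_congr rfl fun i hi ↦ ?_
    rw [Finset.erase_insert_of_ne (by rintro rfl; exact ha hi),
      Finset.prod_insert (by simp [ha])]
    ring

/-- A homogeneous member of an ideal generated by two forms of the same degree is a combination
of them with homogeneous coefficients. -/
lemma exists_isHomogeneous_of_mem_span_pair {σ R : Type*} [CommRing R] {p q r : MvPolynomial σ R}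
    {m n : ℕ} (hp : p.IsHomogeneous m) (hq : q.IsHomogeneous m) (hr : r.IsHomogeneous (n + m))
    (h : r ∈ Ideal.span {p, q}) :
    ∃ a b : MvPolynomial σ R, a.IsHomogeneous n ∧ b.IsHomogeneous n ∧ a * p + b * q = r := by
  classical
  obtain ⟨a, b, hab⟩ := Ideal.mem_span_pair.1 h
  let _ := gradedAlgebra (σ := σ) (R := R)
  have comp (c s : MvPolynomial σ R) (hs : s.IsHomogeneous m) :
      (DirectSum.decompose (homogeneousSubmodule σ R) (c * s) (n + m) : MvPolynomial σ R) =
        (DirectSum.decompose (homogeneousSubmodule σ R) c n : MvPolynomial σ R) * s := by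
    rw [DirectSum.coe_decompose_mul_of_right_mem_of_le (homogeneousSubmodule σ R)
      ((mem_homogeneousSubmodule m s).2 hs) (Nat.le_add_left m n), Nat.add_sub_cancel]
  refine ⟨_, _, (DirectSum.decompose (homogeneousSubmodule σ R) a n).2,
    (DirectSum.decompose (homogeneousSubmodule σ R) b n).2, ?_⟩
  rw [← comp a p hp, ← comp b q hq, ← Submodule.coe_add, ← DirectSum.add_apply,
    ← DirectSum.decompose_add, hab]
  exact DirectSum.decompose_of_mem_same _ ((mem_homogeneousSubmodule _ _).2 hr)

/-- If the first two partial derivatives of `F` are `R p` and `R q` with `p`, `q` coprime forms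
in whose ideal the third one lies, and `R` is coprime to the latter, then `F` is free. -/
lemma isFreeWith_of_pderiv_eq_mul {F R p q : S3} {m n : ℕ} (hmn : m ≤ n)
    (hx : pderiv 0 F = R * p) (hy : pderiv 1 F = R * q)
    (hp : p.IsHomogeneous m) (hq : q.IsHomogeneous m) (hR : R.IsHomogeneous n)
    (hz : (pderiv 2 F).IsHomogeneous (n + m)) (hR0 : R ≠ 0) (hp0 : p ≠ 0)
    (hpq : IsRelPrime p q) (hRz : IsRelPrime R (pderiv 2 F))
    (hmem : pderiv 2 F ∈ Ideal.span {p, q}) : IsFreeWith F m n := by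
  obtain ⟨a, b, ha, hb, hab⟩ := exists_isHomogeneous_of_mem_span_pair hp hq hz hmem
  have mem (j : Fin 2) : (![![q, -p, 0], ![-a, -b, R]] : Fin 2 → Fin 3 → S3) j ∈ jacSyz F := by
    change _ * _ + _ * _ + _ * _ = (0 : S3)
    rw [hx, hy]
    fin_cases j
    · simp
      ring
    · simp
      linear_combination (-R) * hab
  refine ⟨![![q, -p, 0], ![-a, -b, R]], mem, ?_, ?_, ?_, ?_, ?_⟩
  · intro j i
    fin_cases j <;> fin_cases i
    exacts [hq, hp.neg, isHomogeneous_zero _ _ _, ha.neg, hb.neg, hR]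
  · intro j h
    fin_cases j
    · exact hp0 (neg_eq_zero.1 (congrFun h 1))
    · exact hR0 (congrFun h 2)
  · apply le_antisymm
    · rw [Submodule.span_le]
      rintro _ ⟨j, rfl⟩
      exact mem j
    · intro v hv
      change v 0 * _ + v 1 * _ + v 2 * _ = 0 at hv
      rw [hx, hy] at hv
      obtain ⟨c, hc⟩ : R ∣ v 2 :=
        hRz.dvd_of_dvd_mul_right ⟨-(v 0 * p + v 1 * q), by linear_combination hv⟩
      have h0 : (v 0 + c * a) * p + (v 1 + c * b) * q = 0 := by
        apply mul_left_cancel₀ hR0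
        rw [hc] at hv
        linear_combination hv + R * c * hab
      obtain ⟨e, he⟩ : p ∣ v 1 + c * b :=
        hpq.dvd_of_dvd_mul_right ⟨-(v 0 + c * a), by linear_combination h0⟩
      have he' : v 0 + c * a = -(e * q) := by
        apply mul_right_cancel₀ hp0
        rw [he] at h0
        linear_combination h0
      have hv' : v = (-e) • ![q, -p, 0] + c • ![-a, -b, R] := by
        funext i
        fin_cases i
        · simp
          linear_combination he'
        · simp
          linear_combination he
        · simp
          linear_combination hc
      rw [hv']
      exact add_mem (Submodule.smul_mem _ _ (Submodule.subset_span ⟨0, rfl⟩))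
        (Submodule.smul_mem _ _ (Submodule.subset_span ⟨1, rfl⟩))
  · intro j h
    fin_cases j
    · have hs : {j' : Fin 2 | j' ≠ 0} = {1} := by ext j'; fin_cases j' <;> simp
      simp only [Fin.zero_eta, hs, Set.image_singleton, Submodule.mem_span_singleton] at h
      obtain ⟨c, hc⟩ := h
      have hc0 : c = 0 := (mul_eq_zero.1 (congrFun hc 2)).resolve_right hR0
      refine hp0 (neg_eq_zero.1 (Eq.symm ?_))
      simpa [hc0] using congrFun hc 1
    · have hs : {j' : Fin 2 | j' ≠ 1} = {0} := by ext j'; fin_cases j' <;> simp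
      simp only [Fin.mk_one, hs, Set.image_singleton, Submodule.mem_span_singleton] at h
      obtain ⟨c, hc⟩ := h
      exact hR0 (by simpa using (congrFun hc 2).symm)
  · intro i j hij
    fin_cases i <;> fin_cases j <;> simp_all

lemma X_mul_pderiv_add_of_isHomogeneous {F : S3} {n : ℕ} (hF : F.IsHomogeneous n) :
    X 0 * pderiv 0 F + X 1 * pderiv 1 F + X 2 * pderiv 2 F = (n : S3) * F := by
  simpa [Fin.sum_univ_three] using hF.sum_X_mul_pderiv

lemma dvd_of_dvd_natCast_mul {F q : S3} {n : ℕ} (hn : n ≠ 0) (h : q ∣ (n : S3) * F) : q ∣ F := by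
  have hu : IsUnit ((n : ℂ)) := isUnit_iff_ne_zero.2 (Nat.cast_ne_zero.2 hn)
  have hu' : IsUnit ((n : S3)) := by simpa using hu.map (C : ℂ →+* S3)
  exact hu'.dvd_mul_left.1 h

/-- A polynomial not vanishing at the point `(1 : 1 : 0)` has no irreducible factor in common
with `z`. -/
lemma not_dvd_X_two_of_dvd {q R : S3} (hq : Irreducible q) (hqR : q ∣ R)
    (hR : eval ![1, 1, 0] R ≠ 0) : ¬ q ∣ X 2 := by
  intro h
  obtain ⟨s, rfl⟩ := (hq.dvd_symm (X_prime.irreducible) h).trans hqR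
  simp at hR

/-- The properties of a form `f` of degree 10 that make every union of at least two members of
the pencil `f + t z¹⁰ = 0` free. -/
structure HasFreeUnions (f : S3) : Prop where
  isHomogeneous : f.IsHomogeneous 10
  eval_eq_one : eval ![1, 1, 0] f = 1
  eval_pderiv_ne_zero : eval ![1, 1, 0] (pderiv 0 f) ≠ 0
  X_pow_mem : X 2 ^ 17 ∈ Ideal.span {pderiv 0 f, pderiv 1 f}
  mul_X_pow_mem : f * X 2 ^ 8 ∈ Ideal.span {pderiv 0 f, pderiv 1 f}
  mul_pderiv_mem : f * pderiv 2 f ∈ Ideal.span {pderiv 0 f, pderiv 1 f}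

lemma isHomogeneous_add_C_mul_X_pow {f : S3} (hf : f.IsHomogeneous 10) (a : ℂ) :
    (f + C a * X 2 ^ 10).IsHomogeneous 10 :=
  hf.add (by simpa using (isHomogeneous_C (Fin 3) a).mul (isHomogeneous_X_pow 2 10))

/-- The derivative of `∏ j, (f + t j z¹⁰)` with respect to `f`. -/
def pencilDeriv (f : S3) {k : ℕ} (t : Fin k → ℂ) : S3 :=
  ∑ j, ∏ i ∈ Finset.univ.erase j, (f + C (t i) * X 2 ^ 10)

lemma pderiv_prod_pencil (f : S3) {k : ℕ} (t : Fin k → ℂ) {i : Fin 3} (hi : i ≠ 2) :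
    pderiv i (∏ j, (f + C (t j) * X 2 ^ 10)) = pencilDeriv f t * pderiv i f := by
  rw [derivation_prod, pencilDeriv, Finset.sum_mul]
  refine Finset.sum_congr rfl fun j _ ↦ ?_
  simp [Derivation.leibniz_pow, pderiv_X_of_ne hi.symm]

lemma isHomogeneous_prod_pencil {f : S3} (hf : f.IsHomogeneous 10) {k : ℕ} (t : Fin k → ℂ) :
    (∏ j, (f + C (t j) * X 2 ^ 10)).IsHomogeneous (10 * k) := by
  simpa [mul_comm] using IsHomogeneous.prod Finset.univ _ (fun _ ↦ 10)
    fun j _ ↦ isHomogeneous_add_C_mul_X_pow hf (t j)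

lemma isHomogeneous_pencilDeriv {f : S3} (hf : f.IsHomogeneous 10) {k : ℕ} (t : Fin k → ℂ) :
    (pencilDeriv f t).IsHomogeneous (10 * k - 10) := by
  refine IsHomogeneous.sum _ _ _ fun j _ ↦ ?_
  have h := IsHomogeneous.prod (Finset.univ.erase j) _ (fun _ ↦ 10)
    fun i _ ↦ isHomogeneous_add_C_mul_X_pow hf (t i)
  simpa [mul_comm, Nat.sub_mul] using h

lemma eval_prod_pencil {f : S3} (h1 : eval ![1, 1, 0] f = 1) {k : ℕ} (t : Fin k → ℂ) :
    eval ![1, 1, 0] (∏ j, (f + C (t j) * X 2 ^ 10)) = 1 := by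
  simp [h1]

lemma eval_pencilDeriv {f : S3} (h1 : eval ![1, 1, 0] f = 1) {k : ℕ} (t : Fin k → ℂ) :
    eval ![1, 1, 0] (pencilDeriv f t) = k := by
  simp [pencilDeriv, h1]

lemma not_dvd_prod_pencil_of_dvd_pencilDeriv {f : S3} (h1 : eval ![1, 1, 0] f = 1)
    {k : ℕ} (hk : k ≠ 0) {t : Fin k → ℂ} (hinj : Function.Injective t) {q : S3} (hq : Irreducible q)
    (hqP : q ∣ pencilDeriv f t) :
    ¬ q ∣ ∏ j, (f + C (t j) * X 2 ^ 10) := by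
  intro h
  have hz : ¬ q ∣ X 2 := not_dvd_X_two_of_dvd hq hqP (by simpa [eval_pencilDeriv h1] using hk)
  obtain ⟨j, -, hj⟩ := hq.prime.exists_mem_finset_dvd h
  rw [pencilDeriv, ← Finset.add_sum_erase _ _ (Finset.mem_univ j)] at hqP
  rw [dvd_add_left] at hqP
  · obtain ⟨i, hi, hqi⟩ := hq.prime.exists_mem_finset_dvd hqP
    have hd : q ∣ C (t i - t j) * X 2 ^ 10 := by
      have := dvd_sub hqi hj
      rw [C_sub]
      convert this using 1
      ring
    have hu : IsUnit (C (t i - t j) : S3) :=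
      (isUnit_iff_ne_zero.2 (sub_ne_zero.2 (hinj.ne (Finset.ne_of_mem_erase hi)))).map C
    exact hz (hq.prime.dvd_of_dvd_pow (hu.dvd_mul_left.1 hd))
  · exact Finset.dvd_sum fun i hi ↦ hj.trans (Finset.dvd_prod_of_mem _
      (Finset.mem_erase.2 ⟨(Finset.ne_of_mem_erase hi).symm, Finset.mem_univ j⟩))

lemma prod_pencil_mem_and_pderiv_mem {f : S3} (hf : HasFreeUnions f) {k : ℕ} (hk : 2 ≤ k)
    (t : Fin k → ℂ) :
    ∏ j, (f + C (t j) * X 2 ^ 10) ∈ Ideal.span {pderiv 0 f, pderiv 1 f} ∧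
      pderiv 2 (∏ j, (f + C (t j) * X 2 ^ 10)) ∈ Ideal.span {pderiv 0 f, pderiv 1 f} := by
  obtain ⟨hf, -, -, hz17, hfz, hff⟩ := hf
  set I := Ideal.span {pderiv 0 f, pderiv 1 f}
  have hx : pderiv 0 f ∈ I := Ideal.subset_span (by simp)
  have hy : pderiv 1 f ∈ I := Ideal.subset_span (by simp)
  have hE := X_mul_pderiv_add_of_isHomogeneous hf
  have hd (a : ℂ) : pderiv 2 (f + C a * X 2 ^ 10) = pderiv 2 f + 10 * C a * X 2 ^ 9 := by
    simp [Derivation.leibniz_pow]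
    ring
  induction k, hk using Nat.le_induction with
  | base =>
    have hsq : f ^ 2 ∈ I := by
      have h10 : C (10 : ℂ) * f ^ 2 ∈ I := by
        have : C (10 : ℂ) * f ^ 2 = X 2 * (f * pderiv 2 f) +
            (X 0 * f * pderiv 0 f + X 1 * f * pderiv 1 f) := by
          push_cast at hE
          rw [map_ofNat]
          linear_combination (-f) * hE
        rw [this]
        exact add_mem (I.mul_mem_left _ hff) (add_mem (I.mul_mem_left _ hx) (I.mul_mem_left _ hy))
      have : f ^ 2 = C (1 / 10 : ℂ) * (C (10 : ℂ) * f ^ 2) := by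
        rw [← mul_assoc, ← C_mul]
        norm_num
      rw [this]
      exact I.mul_mem_left _ h10
    have hzf : X 2 * pderiv 2 f * X 2 ^ 9 ∈ I := by
      have : X 2 * pderiv 2 f * X 2 ^ 9 = 10 * X 2 * (f * X 2 ^ 8) -
          (X 0 * X 2 ^ 9 * pderiv 0 f + X 1 * X 2 ^ 9 * pderiv 1 f) := by
        push_cast at hE
        linear_combination X 2 ^ 9 * hE
      rw [this]
      exact sub_mem (I.mul_mem_left _ hfz) (add_mem (I.mul_mem_left _ hx) (I.mul_mem_left _ hy))
    rw [Fin.prod_univ_two, Derivation.leibniz, hd, hd, smul_eq_mul, smul_eq_mul]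
    constructor
    · have : (f + C (t 0) * X 2 ^ 10) * (f + C (t 1) * X 2 ^ 10) =
          f ^ 2 + (C (t 0) + C (t 1)) * X 2 ^ 2 * (f * X 2 ^ 8) +
            C (t 0) * C (t 1) * X 2 ^ 3 * X 2 ^ 17 := by ring
      rw [this]
      exact add_mem (add_mem hsq (I.mul_mem_left _ hfz)) (I.mul_mem_left _ hz17)
    · have : (f + C (t 0) * X 2 ^ 10) * (pderiv 2 f + 10 * C (t 1) * X 2 ^ 9) +
          (f + C (t 1) * X 2 ^ 10) * (pderiv 2 f + 10 * C (t 0) * X 2 ^ 9) =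
          2 * (f * pderiv 2 f) + (C (t 0) + C (t 1)) * (X 2 * pderiv 2 f * X 2 ^ 9) +
            10 * (C (t 0) + C (t 1)) * X 2 * (f * X 2 ^ 8) +
            20 * C (t 0) * C (t 1) * X 2 ^ 2 * X 2 ^ 17 := by ring
      rw [this]
      exact add_mem (add_mem (add_mem (I.mul_mem_left _ hff) (I.mul_mem_left _ hzf))
        (I.mul_mem_left _ hfz)) (I.mul_mem_left _ hz17)
  | succ n hn ih =>
    obtain ⟨h, h'⟩ := ih fun j ↦ t j.castSucc
    rw [Fin.prod_univ_castSucc, Derivation.leibniz, smul_eq_mul, smul_eq_mul]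
    exact ⟨I.mul_mem_right _ h, add_mem (I.mul_mem_right _ h) (I.mul_mem_left _ h')⟩

lemma isRelPrime_pderiv {f : S3} (hf : HasFreeUnions f) :
    IsRelPrime (pderiv 0 f) (pderiv 1 f) := by
  refine WfDvdMonoid.isRelPrime_of_no_irreducible_factors
    (fun h ↦ hf.eval_pderiv_ne_zero (by simp [h.1])) ?_
  intro q hq hqx hqy
  refine not_dvd_X_two_of_dvd hq hqx hf.eval_pderiv_ne_zero (hq.prime.dvd_of_dvd_pow (n := 17) ?_)
  obtain ⟨a, b, hab⟩ := Ideal.mem_span_pair.1 hf.X_pow_mem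
  exact hab ▸ dvd_add (hqx.mul_left a) (hqy.mul_left b)

/-- A union of at least two members of the pencil is free. -/
lemma isFreeWith_prod_pencil {f : S3} (hf : HasFreeUnions f) {k : ℕ} (hk : 2 ≤ k)
    {t : Fin k → ℂ} (hinj : Function.Injective t) :
    IsFreeWith (∏ j, (f + C (t j) * X 2 ^ 10)) 9 (10 * k - 10) := by
  have hP0 : eval ![1, 1, 0] (pencilDeriv f t) ≠ 0 := by
    rw [eval_pencilDeriv hf.eval_eq_one, Nat.cast_ne_zero]
    lia
  have hPne : pencilDeriv f t ≠ 0 := fun h ↦ hP0 (by simp [h])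
  have hF := isHomogeneous_prod_pencil hf.isHomogeneous t
  have hFx := pderiv_prod_pencil f t (i := 0) (by decide)
  have hFy := pderiv_prod_pencil f t (i := 1) (by decide)
  have hFz := hF.pderiv (i := 2)
  rw [show 10 * k - 1 = 10 * k - 10 + 9 by lia] at hFz
  refine isFreeWith_of_pderiv_eq_mul (by lia) hFx hFy hf.isHomogeneous.pderiv
    hf.isHomogeneous.pderiv
    (isHomogeneous_pencilDeriv hf.isHomogeneous t) hFz hPne
    (fun h ↦ hf.eval_pderiv_ne_zero (by simp [h]))
    (isRelPrime_pderiv hf) ?_ (prod_pencil_mem_and_pderiv_mem hf hk t).2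
  refine WfDvdMonoid.isRelPrime_of_no_irreducible_factors (fun h ↦ hPne h.1) ?_
  intro q hq hqP hqz
  refine not_dvd_prod_pencil_of_dvd_pencilDeriv hf.eval_eq_one (by lia) hinj hq hqP
    (dvd_of_dvd_natCast_mul (n := 10 * k) (by lia) ?_)
  rw [← X_mul_pderiv_add_of_isHomogeneous hF, hFx, hFy]
  exact dvd_add (dvd_add ((hqP.mul_right _).mul_left _) ((hqP.mul_right _).mul_left _))
    (hqz.mul_left _)

/-- A union of at least two members of the pencil and the line `z = 0` is free. -/
lemma isFreeWith_X_mul_prod_pencil {f : S3} (hf : HasFreeUnions f) {k : ℕ} (hk : 2 ≤ k)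
    {t : Fin k → ℂ} (hinj : Function.Injective t) :
    IsFreeWith (X 2 * ∏ j, (f + C (t j) * X 2 ^ 10)) 9 (10 * k - 9) := by
  have hP0 : eval ![1, 1, 0] (pencilDeriv f t) ≠ 0 := by
    rw [eval_pencilDeriv hf.eval_eq_one, Nat.cast_ne_zero]
    lia
  have hPne : pencilDeriv f t ≠ 0 := fun h ↦ hP0 (by simp [h])
  have hRne : X 2 * pencilDeriv f t ≠ 0 := mul_ne_zero (X_ne_zero 2) hPne
  have hF1 := eval_prod_pencil hf.eval_eq_one t
  have hF := (isHomogeneous_X ℂ 2).mul (isHomogeneous_prod_pencil hf.isHomogeneous t)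
  have hR := (isHomogeneous_X ℂ 2).mul (isHomogeneous_pencilDeriv hf.isHomogeneous t)
  obtain ⟨hmem, hmemz⟩ := prod_pencil_mem_and_pderiv_mem hf hk t
  have hnd (q : S3) (hq : Irreducible q) (hqP : q ∣ pencilDeriv f t) :=
    not_dvd_prod_pencil_of_dvd_pencilDeriv hf.eval_eq_one (by lia) hinj hq hqP
  have hFx := pderiv_prod_pencil f t (i := 0) (by decide)
  have hFy := pderiv_prod_pencil f t (i := 1) (by decide)
  set F := ∏ j, (f + C (t j) * X 2 ^ 10)
  have hGx : pderiv 0 (X 2 * F) = X 2 * pencilDeriv f t * pderiv 0 f := by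
    rw [Derivation.leibniz, pderiv_X_of_ne (by decide), hFx, smul_zero, add_zero, smul_eq_mul,
      mul_assoc]
  have hGy : pderiv 1 (X 2 * F) = X 2 * pencilDeriv f t * pderiv 1 f := by
    rw [Derivation.leibniz, pderiv_X_of_ne (by decide), hFy, smul_zero, add_zero, smul_eq_mul,
      mul_assoc]
  have hGz : pderiv 2 (X 2 * F) = X 2 * pderiv 2 F + F := by
    rw [Derivation.leibniz, pderiv_X_self, smul_eq_mul, smul_eq_mul, mul_one]
  have hGzh := hF.pderiv (i := 2)
  rw [show 1 + 10 * k - 1 = 10 * k - 9 + 9 by lia] at hGzh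
  rw [show 1 + (10 * k - 10) = 10 * k - 9 by lia] at hR
  refine isFreeWith_of_pderiv_eq_mul (by lia) hGx hGy hf.isHomogeneous.pderiv
    hf.isHomogeneous.pderiv
    hR hGzh hRne (fun h ↦ hf.eval_pderiv_ne_zero (by simp [h])) (isRelPrime_pderiv hf) ?_
    (hGz ▸ add_mem (Ideal.mul_mem_left _ _ hmemz) hmem)
  refine WfDvdMonoid.isRelPrime_of_no_irreducible_factors (fun h ↦ hRne h.1) ?_
  intro q hq hqR hqz
  have hzn : ¬ q ∣ X 2 := by
    intro hqX
    rw [hGz, dvd_add_right (hqX.mul_right _)] at hqz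
    exact not_dvd_X_two_of_dvd hq hqz (by simp [hF1]) hqX
  have hqP := (hq.prime.dvd_or_dvd hqR).resolve_left hzn
  have hqG : q ∣ X 2 * F := by
    refine dvd_of_dvd_natCast_mul (n := 1 + 10 * k) (by lia) ?_
    rw [← X_mul_pderiv_add_of_isHomogeneous hF, hGx, hGy]
    exact dvd_add (dvd_add ((hqR.mul_right _).mul_left _) ((hqR.mul_right _).mul_left _))
      (hqz.mul_left _)
  exact hnd q hq hqP ((hq.prime.dvd_or_dvd hqG).resolve_left hzn)

/-- The forms of degree 10 that share the shape of `f0` and `f0'`. -/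
def brianconForm (a b c d e : ℂ) : S3 :=
  X 0 ^ 6 * X 1 ^ 4 + C 4 * X 0 ^ 5 * X 1 ^ 3 * X 2 ^ 2 + C 3 * X 0 ^ 4 * X 1 ^ 3 * X 2 ^ 3 +
    C 6 * X 0 ^ 4 * X 1 ^ 2 * X 2 ^ 4 + C a * X 0 ^ 3 * X 1 ^ 2 * X 2 ^ 5 +
    C 4 * X 0 ^ 3 * X 1 * X 2 ^ 6 + C 3 * X 0 ^ 2 * X 1 ^ 2 * X 2 ^ 6 +
    C b * X 0 ^ 2 * X 1 * X 2 ^ 7 + X 0 ^ 2 * X 2 ^ 8 + C c * X 0 * X 1 * X 2 ^ 8 +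
    C d * X 0 * X 2 ^ 9 + X 1 * X 2 ^ 9 + C e * X 2 ^ 10

lemma f0_eq_brianconForm : f0 = brianconForm (19 / 3) (11 / 3) 2 (1 / 3) (-1) := by
  simp only [f0, brianconForm, map_ofNat, map_neg, map_one]
  ring

lemma f0'_eq_brianconForm : f0' = brianconForm (65 / 9) (49 / 9) (10 / 3) (11 / 9) (1 / 3) := by
  simp only [f0', brianconForm, map_ofNat]

lemma brianconForm_isHomogeneous (a b c d e : ℂ) : (brianconForm a b c d e).IsHomogeneous 10 := by
  have mon (r : ℂ) (i j l : ℕ) (h : i + j + l = 10) :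
      (C r * X 0 ^ i * X 1 ^ j * X 2 ^ l : S3).IsHomogeneous 10 := by
    have h' := (((isHomogeneous_C (Fin 3) r).mul (isHomogeneous_X_pow 0 i)).mul
      (isHomogeneous_X_pow 1 j)).mul (isHomogeneous_X_pow 2 l)
    rwa [zero_add, h] at h'
  have key : brianconForm a b c d e =
      C 1 * X 0 ^ 6 * X 1 ^ 4 * X 2 ^ 0 + C 4 * X 0 ^ 5 * X 1 ^ 3 * X 2 ^ 2 +
        C 3 * X 0 ^ 4 * X 1 ^ 3 * X 2 ^ 3 + C 6 * X 0 ^ 4 * X 1 ^ 2 * X 2 ^ 4 +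
        C a * X 0 ^ 3 * X 1 ^ 2 * X 2 ^ 5 + C 4 * X 0 ^ 3 * X 1 ^ 1 * X 2 ^ 6 +
        C 3 * X 0 ^ 2 * X 1 ^ 2 * X 2 ^ 6 + C b * X 0 ^ 2 * X 1 ^ 1 * X 2 ^ 7 +
        C 1 * X 0 ^ 2 * X 1 ^ 0 * X 2 ^ 8 + C c * X 0 ^ 1 * X 1 ^ 1 * X 2 ^ 8 +
        C d * X 0 ^ 1 * X 1 ^ 0 * X 2 ^ 9 + C 1 * X 0 ^ 0 * X 1 ^ 1 * X 2 ^ 9 +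
        C e * X 0 ^ 0 * X 1 ^ 0 * X 2 ^ 10 := by
    simp only [brianconForm, map_one]
    ring
  rw [key]
  repeat' apply IsHomogeneous.add
  all_goals exact mon _ _ _ _ rfl

lemma eval_brianconForm (a b c d e : ℂ) (v : Fin 3 → ℂ) :
    eval v (brianconForm a b c d e) =
      v 0 ^ 6 * v 1 ^ 4 + 4 * v 0 ^ 5 * v 1 ^ 3 * v 2 ^ 2 + 3 * v 0 ^ 4 * v 1 ^ 3 * v 2 ^ 3 +
        6 * v 0 ^ 4 * v 1 ^ 2 * v 2 ^ 4 + a * v 0 ^ 3 * v 1 ^ 2 * v 2 ^ 5 +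
        4 * v 0 ^ 3 * v 1 * v 2 ^ 6 + 3 * v 0 ^ 2 * v 1 ^ 2 * v 2 ^ 6 +
        b * v 0 ^ 2 * v 1 * v 2 ^ 7 + v 0 ^ 2 * v 2 ^ 8 + c * v 0 * v 1 * v 2 ^ 8 +
        d * v 0 * v 2 ^ 9 + v 1 * v 2 ^ 9 + e * v 2 ^ 10 := by
  simp [brianconForm]

lemma eval_pderiv_zero_brianconForm (a b c d e : ℂ) (v : Fin 3 → ℂ) :
    eval v (pderiv 0 (brianconForm a b c d e)) =
      6 * v 0 ^ 5 * v 1 ^ 4 + 20 * v 0 ^ 4 * v 1 ^ 3 * v 2 ^ 2 +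
        12 * v 0 ^ 3 * v 1 ^ 3 * v 2 ^ 3 + 24 * v 0 ^ 3 * v 1 ^ 2 * v 2 ^ 4 +
        3 * a * v 0 ^ 2 * v 1 ^ 2 * v 2 ^ 5 + 12 * v 0 ^ 2 * v 1 * v 2 ^ 6 +
        6 * v 0 * v 1 ^ 2 * v 2 ^ 6 + 2 * b * v 0 * v 1 * v 2 ^ 7 + 2 * v 0 * v 2 ^ 8 +
        c * v 1 * v 2 ^ 8 + d * v 2 ^ 9 := by
  simp [brianconForm, pderiv_X, Derivation.leibniz_pow]
  ring

lemma eval_pderiv_one_brianconForm (a b c d e : ℂ) (v : Fin 3 → ℂ) :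
    eval v (pderiv 1 (brianconForm a b c d e)) =
      4 * v 0 ^ 6 * v 1 ^ 3 + 12 * v 0 ^ 5 * v 1 ^ 2 * v 2 ^ 2 +
        9 * v 0 ^ 4 * v 1 ^ 2 * v 2 ^ 3 + 12 * v 0 ^ 4 * v 1 * v 2 ^ 4 +
        2 * a * v 0 ^ 3 * v 1 * v 2 ^ 5 + 4 * v 0 ^ 3 * v 2 ^ 6 + 6 * v 0 ^ 2 * v 1 * v 2 ^ 6 +
        b * v 0 ^ 2 * v 2 ^ 7 + c * v 0 * v 2 ^ 8 + v 2 ^ 9 := by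
  simp [brianconForm, pderiv_X, Derivation.leibniz_pow]
  ring

lemma eval_pderiv_two_brianconForm (a b c d e : ℂ) (v : Fin 3 → ℂ) :
    eval v (pderiv 2 (brianconForm a b c d e)) =
      8 * v 0 ^ 5 * v 1 ^ 3 * v 2 + 9 * v 0 ^ 4 * v 1 ^ 3 * v 2 ^ 2 +
        24 * v 0 ^ 4 * v 1 ^ 2 * v 2 ^ 3 + 5 * a * v 0 ^ 3 * v 1 ^ 2 * v 2 ^ 4 +
        24 * v 0 ^ 3 * v 1 * v 2 ^ 5 + 18 * v 0 ^ 2 * v 1 ^ 2 * v 2 ^ 5 +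
        7 * b * v 0 ^ 2 * v 1 * v 2 ^ 6 + 8 * v 0 ^ 2 * v 2 ^ 7 + 8 * c * v 0 * v 1 * v 2 ^ 7 +
        9 * d * v 0 * v 2 ^ 8 + 9 * v 1 * v 2 ^ 8 + 10 * e * v 2 ^ 9 := by
  simp [brianconForm, pderiv_X, Derivation.leibniz_pow]
  ring

lemma X_pow_mem_span_pderiv_f0 :
    X 2 ^ 17 ∈ Ideal.span {pderiv 0 f0, pderiv 1 f0} := by
  rw [Ideal.mem_span_pair, f0_eq_brianconForm]
  refine ⟨
      C 4 * X 0 ^ 4 * X 1 * X 2 ^ 3 + C 4 * X 0 ^ 3 * X 2 ^ 5 + X 0 ^ 2 * X 2 ^ 6,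
      -C 6 * X 0 ^ 3 * X 1 ^ 2 * X 2 ^ 3 - C 8 * X 0 ^ 2 * X 1 * X 2 ^ 5 - C 2 * X 0 * X 2 ^ 7 +
        X 2 ^ 8,
      MvPolynomial.funext fun v ↦ ?_⟩
  simp only [RingHom.map_add, RingHom.map_sub, RingHom.map_mul, RingHom.map_neg,
    RingHom.map_pow, eval_X, eval_C, eval_pderiv_zero_brianconForm, eval_pderiv_one_brianconForm]
  ring

lemma f0_mul_X_pow_mem_span_pderiv :
    f0 * X 2 ^ 8 ∈ Ideal.span {pderiv 0 f0, pderiv 1 f0} := by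
  rw [Ideal.mem_span_pair, f0_eq_brianconForm]
  refine ⟨
      C (8 / 3) * X 0 ^ 5 * X 1 ^ 2 * X 2 ^ 2 - C (16 / 9) * X 0 ^ 4 * X 1 * X 2 ^ 4 +
        C 4 * X 0 ^ 3 * X 1 * X 2 ^ 5 - C (40 / 9) * X 0 ^ 3 * X 2 ^ 6 -
        C (4 / 3) * X 0 ^ 2 * X 2 ^ 7 + C (1 / 3) * X 0 * X 2 ^ 8,
      -C 4 * X 0 ^ 4 * X 1 ^ 3 * X 2 ^ 2 + C (4 / 3) * X 0 ^ 3 * X 1 ^ 2 * X 2 ^ 4 -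
        C 5 * X 0 ^ 2 * X 1 ^ 2 * X 2 ^ 5 + C (68 / 9) * X 0 ^ 2 * X 1 * X 2 ^ 6 -
        C (2 / 3) * X 0 * X 1 * X 2 ^ 7 + C (20 / 9) * X 0 * X 2 ^ 8 + X 1 * X 2 ^ 8 - X 2 ^ 9,
      MvPolynomial.funext fun v ↦ ?_⟩
  simp only [RingHom.map_add, RingHom.map_sub, RingHom.map_mul, RingHom.map_neg,
    RingHom.map_pow, eval_X, eval_C, eval_brianconForm,
    eval_pderiv_zero_brianconForm, eval_pderiv_one_brianconForm]
  ring

set_option maxHeartbeats 2000000 in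
lemma f0_mul_pderiv_mem_span_pderiv :
    f0 * pderiv 2 f0 ∈ Ideal.span {pderiv 0 f0, pderiv 1 f0} := by
  rw [Ideal.mem_span_pair, f0_eq_brianconForm]
  refine ⟨
      C (4 / 3) * X 0 ^ 6 * X 1 ^ 3 * X 2 - C (9 / 2) * X 0 ^ 5 * X 1 ^ 3 * X 2 ^ 2 -
        C (1172 / 27) * X 0 ^ 5 * X 1 ^ 2 * X 2 ^ 3 + C (235 / 18) * X 0 ^ 4 * X 1 ^ 2 * X 2 ^ 4 +
        C (2884 / 81) * X 0 ^ 4 * X 1 * X 2 ^ 5 - C 9 * X 0 ^ 3 * X 1 ^ 2 * X 2 ^ 5 -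
        C (599 / 18) * X 0 ^ 3 * X 1 * X 2 ^ 6 + C (6508 / 81) * X 0 ^ 3 * X 2 ^ 7 +
        C (218 / 9) * X 0 ^ 2 * X 1 * X 2 ^ 7 + C (2375 / 54) * X 0 ^ 2 * X 2 ^ 8 -
        C (9 / 2) * X 0 * X 1 * X 2 ^ 8 + C (221 / 27) * X 0 * X 2 ^ 9 + C (41 / 6) * X 2 ^ 10,
      C 9 * X 0 ^ 4 * X 1 ^ 4 * X 2 ^ 2 + C (652 / 9) * X 0 ^ 4 * X 1 ^ 3 * X 2 ^ 3 -
        C (31 / 6) * X 0 ^ 3 * X 1 ^ 3 * X 2 ^ 4 - C (532 / 27) * X 0 ^ 3 * X 1 ^ 2 * X 2 ^ 5 +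
        C 18 * X 0 ^ 2 * X 1 ^ 3 * X 2 ^ 5 + C (779 / 18) * X 0 ^ 2 * X 1 ^ 2 * X 2 ^ 6 -
        C (10556 / 81) * X 0 ^ 2 * X 1 * X 2 ^ 7 - C 16 * X 0 * X 1 ^ 2 * X 2 ^ 7 -
        C (1601 / 54) * X 0 * X 1 * X 2 ^ 8 - C (3092 / 81) * X 0 * X 2 ^ 9 +
        C 9 * X 1 ^ 2 * X 2 ^ 8 - C (98 / 3) * X 1 * X 2 ^ 9 + C (139 / 18) * X 2 ^ 10,
      MvPolynomial.funext fun v ↦ ?_⟩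
  simp only [RingHom.map_add, RingHom.map_sub, RingHom.map_mul, RingHom.map_pow,
    eval_X, eval_C, eval_brianconForm,
    eval_pderiv_zero_brianconForm, eval_pderiv_one_brianconForm, eval_pderiv_two_brianconForm]
  ring

lemma X_pow_mem_span_pderiv_f0' :
    X 2 ^ 17 ∈ Ideal.span {pderiv 0 f0', pderiv 1 f0'} := by
  rw [Ideal.mem_span_pair, f0'_eq_brianconForm]
  refine ⟨
      -C 48 * X 0 ^ 6 * X 1 ^ 2 - C 96 * X 0 ^ 5 * X 1 * X 2 ^ 2 - C 72 * X 0 ^ 4 * X 1 * X 2 ^ 3 -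
        C 48 * X 0 ^ 4 * X 2 ^ 4 - C (88 / 3) * X 0 ^ 3 * X 2 ^ 5 - C 15 * X 0 ^ 2 * X 2 ^ 6,
      C 72 * X 0 ^ 5 * X 1 ^ 3 + C 168 * X 0 ^ 4 * X 1 ^ 2 * X 2 ^ 2 +
        C 90 * X 0 ^ 3 * X 1 ^ 2 * X 2 ^ 3 + C 120 * X 0 ^ 3 * X 1 * X 2 ^ 4 +
        C 44 * X 0 ^ 2 * X 1 * X 2 ^ 5 + C 24 * X 0 ^ 2 * X 2 ^ 6 - C (10 / 3) * X 0 * X 2 ^ 7 +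
        X 2 ^ 8,
      MvPolynomial.funext fun v ↦ ?_⟩
  simp only [RingHom.map_add, RingHom.map_sub, RingHom.map_mul, RingHom.map_neg,
    RingHom.map_pow, eval_X, eval_C, eval_pderiv_zero_brianconForm, eval_pderiv_one_brianconForm]
  ring

lemma f0'_mul_X_pow_mem_span_pderiv :
    f0' * X 2 ^ 8 ∈ Ideal.span {pderiv 0 f0', pderiv 1 f0'} := by
  rw [Ideal.mem_span_pair, f0'_eq_brianconForm]
  refine ⟨
      -C (8 / 3) * X 0 ^ 5 * X 1 ^ 2 * X 2 ^ 2 - C (16 / 3) * X 0 ^ 4 * X 1 * X 2 ^ 4 -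
        C (8 / 3) * X 0 ^ 3 * X 1 * X 2 ^ 5 - C (8 / 3) * X 0 ^ 3 * X 2 ^ 6 -
        C (8 / 3) * X 0 ^ 2 * X 2 ^ 7 - X 0 * X 2 ^ 8,
      C 4 * X 0 ^ 4 * X 1 ^ 3 * X 2 ^ 2 + C (28 / 3) * X 0 ^ 3 * X 1 ^ 2 * X 2 ^ 4 +
        C 3 * X 0 ^ 2 * X 1 ^ 2 * X 2 ^ 5 + C (20 / 3) * X 0 ^ 2 * X 1 * X 2 ^ 6 +
        C (10 / 3) * X 0 * X 1 * X 2 ^ 7 + C (4 / 3) * X 0 * X 2 ^ 8 + X 1 * X 2 ^ 8 +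
        C (1 / 3) * X 2 ^ 9,
      MvPolynomial.funext fun v ↦ ?_⟩
  simp only [RingHom.map_add, RingHom.map_sub, RingHom.map_mul, RingHom.map_neg,
    RingHom.map_pow, eval_X, eval_C, eval_brianconForm,
    eval_pderiv_zero_brianconForm, eval_pderiv_one_brianconForm]
  ring

set_option maxHeartbeats 2000000 in
lemma f0'_mul_pderiv_mem_span_pderiv :
    f0' * pderiv 2 f0' ∈ Ideal.span {pderiv 0 f0', pderiv 1 f0'} := by
  rw [Ideal.mem_span_pair, f0'_eq_brianconForm]
  refine ⟨
      C (4 / 3) * X 0 ^ 6 * X 1 ^ 3 * X 2 - C (9 / 2) * X 0 ^ 5 * X 1 ^ 3 * X 2 ^ 2 +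
        C (6092 / 243) * X 0 ^ 5 * X 1 ^ 2 * X 2 ^ 3 + C (67 / 18) * X 0 ^ 4 * X 1 ^ 2 * X 2 ^ 4 +
        C (11212 / 243) * X 0 ^ 4 * X 1 * X 2 ^ 5 - C 9 * X 0 ^ 3 * X 1 ^ 2 * X 2 ^ 5 +
        C (19843 / 486) * X 0 ^ 3 * X 1 * X 2 ^ 6 + C (5444 / 243) * X 0 ^ 3 * X 2 ^ 7 +
        C (212 / 27) * X 0 ^ 2 * X 1 * X 2 ^ 7 + C (15847 / 486) * X 0 ^ 2 * X 2 ^ 8 -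
        C (9 / 2) * X 0 * X 1 * X 2 ^ 8 + C (1613 / 81) * X 0 * X 2 ^ 9 + C (289 / 54) * X 2 ^ 10,
      C 9 * X 0 ^ 4 * X 1 ^ 4 * X 2 ^ 2 - C (2452 / 81) * X 0 ^ 4 * X 1 ^ 3 * X 2 ^ 3 +
        C (179 / 18) * X 0 ^ 3 * X 1 ^ 3 * X 2 ^ 4 -
        C (16948 / 243) * X 0 ^ 3 * X 1 ^ 2 * X 2 ^ 5 + C 18 * X 0 ^ 2 * X 1 ^ 3 * X 2 ^ 5 -
        C (1751 / 54) * X 0 ^ 2 * X 1 ^ 2 * X 2 ^ 6 - C (11828 / 243) * X 0 ^ 2 * X 1 * X 2 ^ 7 +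
        C (86 / 9) * X 0 * X 1 ^ 2 * X 2 ^ 7 - C (18857 / 486) * X 0 * X 1 * X 2 ^ 8 -
        C (2236 / 243) * X 0 * X 2 ^ 9 + C 9 * X 1 ^ 2 * X 2 ^ 8 - C (932 / 81) * X 1 * X 2 ^ 9 -
        C (2639 / 486) * X 2 ^ 10,
      MvPolynomial.funext fun v ↦ ?_⟩
  simp only [RingHom.map_add, RingHom.map_sub, RingHom.map_mul, RingHom.map_pow,
    eval_X, eval_C, eval_brianconForm,
    eval_pderiv_zero_brianconForm, eval_pderiv_one_brianconForm, eval_pderiv_two_brianconForm]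
  ring

lemma hasFreeUnions_f0 : HasFreeUnions f0 where
  isHomogeneous := f0_eq_brianconForm ▸ brianconForm_isHomogeneous _ _ _ _ _
  eval_eq_one := by simp [f0_eq_brianconForm, eval_brianconForm]
  eval_pderiv_ne_zero := by simp [f0_eq_brianconForm, eval_pderiv_zero_brianconForm]
  X_pow_mem := X_pow_mem_span_pderiv_f0
  mul_X_pow_mem := f0_mul_X_pow_mem_span_pderiv
  mul_pderiv_mem := f0_mul_pderiv_mem_span_pderiv

lemma hasFreeUnions_f0' : HasFreeUnions f0' where
  isHomogeneous := f0'_eq_brianconForm ▸ brianconForm_isHomogeneous _ _ _ _ _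
  eval_eq_one := by simp [f0'_eq_brianconForm, eval_brianconForm]
  eval_pderiv_ne_zero := by simp [f0'_eq_brianconForm, eval_pderiv_zero_brianconForm]
  X_pow_mem := X_pow_mem_span_pderiv_f0'
  mul_X_pow_mem := f0'_mul_X_pow_mem_span_pderiv
  mul_pderiv_mem := f0'_mul_pderiv_mem_span_pderiv

/-- Any union of `k ≥ 2` distinct members of the pencil `f₀ + t z¹⁰ = 0` is a free curve
with exponents `(9, 10k-10)`, and its union with the line at infinity `L_z : z = 0` is
free with exponents `(9, 10k-9)`; the same holds for the pencil `f'₀ + t z¹⁰ = 0`. -/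
theorem statement19 (k : ℕ) (hk : 2 ≤ k) (t : Fin k → ℂ) (hinj : Function.Injective t) :
    (IsFreeWith (∏ j, (f0 + C (t j) * X 2 ^ 10)) 9 (10 * k - 10) ∧
      IsFreeWith (X 2 * ∏ j, (f0 + C (t j) * X 2 ^ 10)) 9 (10 * k - 9)) ∧
    (IsFreeWith (∏ j, (f0' + C (t j) * X 2 ^ 10)) 9 (10 * k - 10) ∧
      IsFreeWith (X 2 * ∏ j, (f0' + C (t j) * X 2 ^ 10)) 9 (10 * k - 9)) :=
  ⟨⟨isFreeWith_prod_pencil hasFreeUnions_f0 hk hinj,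
      isFreeWith_X_mul_prod_pencil hasFreeUnions_f0 hk hinj⟩,
    isFreeWith_prod_pencil hasFreeUnions_f0' hk hinj,
    isFreeWith_X_mul_prod_pencil hasFreeUnions_f0' hk hinj⟩

end
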